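/- arXiv:1009.4549 — 2 statements merged into one kernel-verified Lean document; each statement's English description precedes it below -/
import Mathlib

section
/- Let μ, ν ∈ ℝ with μ+ν > −2 and μ−ν > −2. Then for every j ∈ ℕ₀ one has ∫_0^∞ |Λ_{2,j}^{μ,ν}(x)|²·x^{μ+ν+1} dx < ∞, i.e. Λ_{2,j}^{μ,ν} belongs to L²((0,∞), x^{μ+ν+1}dx). -/
noncomputable section

open Set MeasureTheory Filter Topology

/-- The Euler operator `θ = x·d/dx` acting on real-valued functions on `ℝ`. -/
def eulerOp (u : ℝ → ℝ) : ℝ → ℝ := fun x => x * deriv u x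

/-- The operator `(θ + a)(θ + b) − x²` applied to `v`. -/
def quadOp (a b : ℝ) (v : ℝ → ℝ) : ℝ → ℝ := fun x =>
  eulerOp (fun y => eulerOp v y + b * v y) x
    + a * (eulerOp v x + b * v x) - x ^ 2 * v x

/-- The fourth-order operator `D_{μ,ν} = x⁻²((θ+μ+ν)(θ+μ) − x²)(θ(θ+ν) − x²)`. -/
def Dop (μ ν : ℝ) (u : ℝ → ℝ) : ℝ → ℝ := fun x =>
  quadOp (μ + ν) μ (quadOp 0 ν u) x / x ^ 2

/-- The normalized I-Bessel function `Ĩ_α(z) = Σ (z/2)^{2n}/(n!·Γ(n+α+1))`. -/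
def tildeI (α z : ℝ) : ℝ :=
  ∑' n : ℕ, (z / 2) ^ (2 * n) / ((n.factorial : ℝ) * Real.Gamma ((n : ℝ) + α + 1))

/-- The K-Bessel function `K_α(z) = ∫₀^∞ e^{−z·cosh s}·cosh(α·s) ds`. -/
def besselK (α z : ℝ) : ℝ :=
  ∫ s in Ioi (0 : ℝ), Real.exp (-z * Real.cosh s) * Real.cosh (α * s)

/-- The normalized K-Bessel function `K̃_α(z) = (z/2)^{−α}·K_α(z)`. -/
def tildeK (α z : ℝ) : ℝ := (z / 2) ^ (-α) * besselK α z

/-- The generating function `G₁^{μ,ν}(t,x)`. -/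
def genG₁ (μ ν t x : ℝ) : ℝ :=
  (1 - t) ^ (-(μ + ν + 2) / 2) * tildeI (μ / 2) (t * x / (1 - t)) * tildeI (ν / 2) (x / (1 - t))

/-- The generating function `G₂^{μ,ν}(t,x)`. -/
def genG₂ (μ ν t x : ℝ) : ℝ :=
  (1 - t) ^ (-(μ + ν + 2) / 2) * tildeI (μ / 2) (t * x / (1 - t)) * tildeK (ν / 2) (x / (1 - t))

/-- The generating function `G₃^{μ,ν}(t,x)`. -/
def genG₃ (μ ν t x : ℝ) : ℝ :=
  (1 - t) ^ (-(μ + ν + 2) / 2) * tildeK (μ / 2) (t * x / (1 - t)) * tildeI (ν / 2) (x / (1 - t))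

/-- The generating function `G₄^{μ,ν}(t,x)`. -/
def genG₄ (μ ν t x : ℝ) : ℝ :=
  (1 - t) ^ (-(μ + ν + 2) / 2) * tildeK (μ / 2) (t * x / (1 - t)) * tildeK (ν / 2) (x / (1 - t))

/-- `Λ₁ⱼ^{μ,ν}(x) = (1/j!)·(∂/∂t)^j|₀ G₁^{μ,ν}(t,x)`. -/
def Lambda₁ (μ ν : ℝ) (j : ℕ) (x : ℝ) : ℝ :=
  iteratedDeriv j (fun t => genG₁ μ ν t x) 0 / (j.factorial : ℝ)

/-- `Λ₂ⱼ^{μ,ν}(x) = (1/j!)·(∂/∂t)^j|₀ G₂^{μ,ν}(t,x)`. -/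
def Lambda₂ (μ ν : ℝ) (j : ℕ) (x : ℝ) : ℝ :=
  iteratedDeriv j (fun t => genG₂ μ ν t x) 0 / (j.factorial : ℝ)

/-- `Λ₁ⱼ` for integer `j`, vanishing for `j < 0`. -/
def Lambda₁Z (μ ν : ℝ) (j : ℤ) (x : ℝ) : ℝ :=
  if 0 ≤ j then Lambda₁ μ ν j.toNat x else 0

/-- `Λ₂ⱼ` for integer `j`, vanishing for `j < 0`. -/
def Lambda₂Z (μ ν : ℝ) (j : ℤ) (x : ℝ) : ℝ :=
  if 0 ≤ j then Lambda₂ μ ν j.toNat x else 0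

/-- For `μ = m` a positive odd integer, `Λ₃ⱼ^{μ,ν}(x) = (1/(j+μ)!)·(∂/∂t)^{j+μ}|₀ [tᵐ·G₃]`,
the derivative at `0` being the limit from the right of the `(j+μ)`-th derivative of the
real-analytic function `t ↦ tᵐ·G₃^{m,ν}(t,x)` on `(0,1)`; it vanishes for `j < −μ`. -/
def Lambda₃ (m : ℕ) (ν : ℝ) (j : ℤ) (x : ℝ) : ℝ :=
  if -(m : ℤ) ≤ j then
    limUnder (𝓝[>] (0 : ℝ))
        (fun t => iteratedDeriv (j + (m : ℤ)).toNat (fun s => s ^ m * genG₃ (m : ℝ) ν s x) t) /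
      (((j + (m : ℤ)).toNat.factorial : ℝ))
  else 0

/-- For `μ = m` a positive odd integer, `Λ₄ⱼ^{μ,ν}(x) = (1/(j+μ)!)·(∂/∂t)^{j+μ}|₀ [tᵐ·G₄]`,
vanishing for `j < −μ`. -/
def Lambda₄ (m : ℕ) (ν : ℝ) (j : ℤ) (x : ℝ) : ℝ :=
  if -(m : ℤ) ≤ j then
    limUnder (𝓝[>] (0 : ℝ))
        (fun t => iteratedDeriv (j + (m : ℤ)).toNat (fun s => s ^ m * genG₄ (m : ℝ) ν s x) t) /
      (((j + (m : ℤ)).toNat.factorial : ℝ))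
  else 0

open scoped ContDiff

lemma exists_rpow_mul_exp_neg_half_le {r : ℝ} (hr : 0 ≤ r) :
    ∃ C : ℝ, 0 ≤ C ∧ ∀ u : ℝ, 0 ≤ u → u ^ r * Real.exp (-u / 2) ≤ C := by
  set N := ⌈r⌉₊
  refine ⟨2 ^ N * N.factorial * Real.exp (1 / 2), by positivity, fun u hu => ?_⟩
  have h1 : u ^ r ≤ (1 + u) ^ N := by
    rw [← Real.rpow_natCast]
    exact (Real.rpow_le_rpow hu (by linarith) hr).trans
      (Real.rpow_le_rpow_of_exponent_le (by linarith) (Nat.le_ceil r))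
  have h2 := Real.pow_div_factorial_le_exp (x := (1 + u) / 2) (by positivity) N
  rw [div_le_iff₀ (by positivity), div_pow, div_le_iff₀ (by positivity)] at h2
  calc u ^ r * Real.exp (-u / 2)
      ≤ (Real.exp ((1 + u) / 2) * N.factorial * 2 ^ N) * Real.exp (-u / 2) := by
        gcongr; exact h1.trans h2
    _ = 2 ^ N * N.factorial * (Real.exp ((1 + u) / 2) * Real.exp (-u / 2)) := by ring
    _ = _ := by rw [← Real.exp_add]; congr 2; ring

/-- The `p`-th moment `∫₀^∞ e^{−z·cosh s}·cosh(s)ᵖ·cosh(α·s) ds`, equal to `(-1)ᵖ` times the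
`p`-th derivative of `K_α`. -/
def besselKMoment (α : ℝ) (p : ℕ) (z : ℝ) : ℝ :=
  ∫ s in Ioi (0 : ℝ), Real.exp (-z * Real.cosh s) * Real.cosh s ^ p * Real.cosh (α * s)

lemma cosh_le_exp_abs (x : ℝ) : Real.cosh x ≤ Real.exp |x| := by
  rw [← Real.cosh_abs, Real.cosh_eq]
  have := Real.exp_le_exp.2 (show -|x| ≤ |x| by linarith [abs_nonneg x])
  linarith

lemma exists_besselK_integrand_le (α : ℝ) {δ : ℝ} (hδ : 0 < δ) (m : ℕ) :
    ∃ C : ℝ, 0 ≤ C ∧ ∀ p ≤ m, ∀ y : ℝ, 0 < y → ∀ s : ℝ, 0 ≤ s →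
      y ^ m * (Real.exp (-y * Real.cosh s) * Real.cosh s ^ p * Real.cosh (α * s)) ≤
        C * (y ^ (-(|α| + δ)) * Real.exp (-y / 2)) * Real.exp (-δ * s) := by
  set a := |α| + δ
  have ha : 0 ≤ a := by positivity
  obtain ⟨C, hC, hb⟩ := exists_rpow_mul_exp_neg_half_le (r := m + a) (by positivity)
  refine ⟨C * 2 ^ a, by positivity, fun p hp y hy s hs => ?_⟩
  set c := Real.cosh s with hc
  have hc1 : 1 ≤ c := Real.one_le_cosh s
  have hc0 : 0 < c := by linarith
  have h1 : Real.cosh (α * s) ≤ (2 * c) ^ a * Real.exp (-δ * s) := by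
    have h : Real.exp s ≤ 2 * c := by
      rw [hc, Real.cosh_eq]; linarith [Real.exp_pos (-s)]
    calc Real.cosh (α * s) ≤ Real.exp (|α| * s) := by
          simpa [abs_mul, abs_of_nonneg hs] using cosh_le_exp_abs (α * s)
      _ = Real.exp s ^ a * Real.exp (-δ * s) := by
          rw [← Real.exp_mul, ← Real.exp_add]; congr 1; simp only [a]; ring
      _ ≤ _ := by gcongr
  have h2 : y ^ m * c ^ p ≤ (y * c) ^ m := by
    rw [mul_pow]; gcongr
  have h3 : Real.exp (-y * c) ≤ Real.exp (-(y * c) / 2) * Real.exp (-y / 2) := by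
    rw [← Real.exp_add, Real.exp_le_exp]; nlinarith
  have h4 : (2 * c) ^ a = 2 ^ a * ((y * c) ^ a * y ^ (-a)) := by
    rw [Real.mul_rpow (by norm_num) hc0.le, Real.mul_rpow hy.le hc0.le, Real.rpow_neg hy.le]
    field_simp
  have h5 : (y * c) ^ m * (y * c) ^ a = (y * c) ^ ((m : ℝ) + a) := by
    rw [← Real.rpow_natCast, ← Real.rpow_add (by positivity)]
  calc y ^ m * (Real.exp (-y * c) * c ^ p * Real.cosh (α * s))
      = (y ^ m * c ^ p) * Real.exp (-y * c) * Real.cosh (α * s) := by ring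
    _ ≤ (y * c) ^ m * (Real.exp (-(y * c) / 2) * Real.exp (-y / 2)) *
          ((2 * c) ^ a * Real.exp (-δ * s)) := by gcongr
    _ = ((y * c) ^ ((m : ℝ) + a) * Real.exp (-(y * c) / 2)) *
          (2 ^ a * y ^ (-a) * Real.exp (-y / 2) * Real.exp (-δ * s)) := by
        rw [h4, ← h5]; ring
    _ ≤ C * (2 ^ a * y ^ (-a) * Real.exp (-y / 2) * Real.exp (-δ * s)) := by
        gcongr; exact hb _ (by positivity)
    _ = _ := by ring

lemma integrableOn_besselKMoment_integrand (α : ℝ) (p : ℕ) {y : ℝ} (hy : 0 < y) :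
    IntegrableOn (fun s => Real.exp (-y * Real.cosh s) * Real.cosh s ^ p * Real.cosh (α * s))
      (Ioi (0 : ℝ)) := by
  obtain ⟨C, -, hb⟩ := exists_besselK_integrand_le α one_pos p
  refine (((exp_neg_integrableOn_Ioi 0 (b := 1) one_pos).const_mul
    (C * (y ^ (-(|α| + 1)) * Real.exp (-y / 2)))).const_mul (y ^ p)⁻¹).mono'
    (Continuous.aestronglyMeasurable (by fun_prop)) ?_
  filter_upwards [ae_restrict_mem measurableSet_Ioi] with s hs
  rw [Real.norm_of_nonneg (by positivity), le_inv_mul_iff₀ (by positivity)]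
  exact hb p le_rfl y hy s (le_of_lt hs)

lemma besselKMoment_nonneg (α : ℝ) (p : ℕ) (y : ℝ) : 0 ≤ besselKMoment α p y :=
  integral_nonneg fun s => by positivity

lemma exists_pow_mul_besselKMoment_le (α : ℝ) {δ : ℝ} (hδ : 0 < δ) {p m : ℕ} (hp : p ≤ m) :
    ∃ C : ℝ, 0 ≤ C ∧ ∀ y : ℝ, 0 < y →
      y ^ m * besselKMoment α p y ≤ C * (y ^ (-(|α| + δ)) * Real.exp (-y / 2)) := by
  obtain ⟨C, hC, hb⟩ := exists_besselK_integrand_le α hδ m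
  refine ⟨C * ∫ s in Ioi (0 : ℝ), Real.exp (-δ * s),
    mul_nonneg hC (integral_nonneg fun s => (Real.exp_pos _).le), fun y hy => ?_⟩
  calc y ^ m * besselKMoment α p y
      ≤ ∫ s in Ioi (0 : ℝ), C * (y ^ (-(|α| + δ)) * Real.exp (-y / 2)) * Real.exp (-δ * s) := by
        rw [besselKMoment, ← integral_const_mul]
        exact setIntegral_mono_on ((integrableOn_besselKMoment_integrand α p hy).const_mul _)
          ((exp_neg_integrableOn_Ioi 0 hδ).const_mul _) measurableSet_Ioi
          fun s hs => hb p hp y hy s (le_of_lt hs)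
    _ = _ := by rw [integral_const_mul]; ring

lemma hasDerivAt_besselKMoment (α : ℝ) (p : ℕ) {y : ℝ} (hy : 0 < y) :
    HasDerivAt (besselKMoment α p) (-besselKMoment α (p + 1) y) y := by
  have h := (hasDerivAt_integral_of_dominated_loc_of_deriv_le
    (μ := volume.restrict (Ioi (0 : ℝ))) (x₀ := y) (s := Ioi (y / 2))
    (F := fun y s => Real.exp (-y * Real.cosh s) * Real.cosh s ^ p * Real.cosh (α * s))
    (F' := fun y s => -(Real.exp (-y * Real.cosh s) * Real.cosh s ^ (p + 1) * Real.cosh (α * s)))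
    (bound := fun s =>
      Real.exp (-(y / 2) * Real.cosh s) * Real.cosh s ^ (p + 1) * Real.cosh (α * s))
    (Ioi_mem_nhds (by linarith))
    (Eventually.of_forall fun z => Continuous.aestronglyMeasurable (by fun_prop))
    (integrableOn_besselKMoment_integrand α p hy)
    (Continuous.aestronglyMeasurable (by fun_prop))
    (Eventually.of_forall fun s z hz => ?_)
    (integrableOn_besselKMoment_integrand α (p + 1) (by linarith))
    (Eventually.of_forall fun s z hz => ?_)).2
  · rw [integral_neg] at h
    exact h
  · rw [norm_neg, Real.norm_of_nonneg (by positivity)]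
    have : -z * Real.cosh s ≤ -(y / 2) * Real.cosh s :=
      mul_le_mul_of_nonneg_right (by linarith [mem_Ioi.1 hz]) (by positivity)
    gcongr
  · have h1 : HasDerivAt (fun z : ℝ => -z * Real.cosh s) (-1 * Real.cosh s) z :=
      (hasDerivAt_id z).neg.mul_const _
    exact ((h1.exp.mul_const (Real.cosh s ^ p)).mul_const (Real.cosh (α * s))).congr_deriv (by ring)

lemma continuousOn_besselKMoment (α : ℝ) (p : ℕ) : ContinuousOn (besselKMoment α p) (Ioi 0) :=
  fun _ hy => (hasDerivAt_besselKMoment α p hy).continuousAt.continuousWithinAt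

lemma contDiff_tildeI {α : ℝ} (hα : -1 < α) : ContDiff ℝ ∞ (tildeI α) := by
  set c : ℕ → ℝ := fun n => ((n.factorial : ℝ) * Real.Gamma ((n : ℝ) + α + 1))⁻¹ with hc
  have hpos (n : ℕ) : 0 < (n : ℝ) + α + 1 := by have := n.cast_nonneg (α := ℝ); linarith
  have hc0 (n : ℕ) : 0 < c n := by
    have := Real.Gamma_pos_of_pos (hpos n); positivity
  have hratio (n : ℕ) : ‖c n.succ‖ / ‖c n‖ = ((n : ℝ) + 1)⁻¹ * ((n : ℝ) + α + 1)⁻¹ := by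
    rw [Real.norm_of_nonneg (hc0 _).le, Real.norm_of_nonneg (hc0 _).le]
    simp only [hc, Nat.succ_eq_add_one, Nat.factorial_succ, Nat.cast_mul, Nat.cast_add,
      Nat.cast_one]
    rw [show (n : ℝ) + 1 + α + 1 = ((n : ℝ) + α + 1) + 1 by ring, Real.Gamma_add_one (hpos n).ne']
    have := Real.Gamma_pos_of_pos (hpos n)
    have := hpos n
    field_simp
  have hrad : (FormalMultilinearSeries.ofScalars ℝ c).radius = ⊤ := by
    refine FormalMultilinearSeries.ofScalars_radius_eq_top_of_tendsto ℝ c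
      (Eventually.of_forall fun n => (hc0 n).ne') ?_
    simp_rw [hratio]
    have h1 : Tendsto (fun n : ℕ => (n : ℝ)) atTop atTop := tendsto_natCast_atTop_atTop
    have h2 : Tendsto (fun n : ℕ => ((n : ℝ) + 1)⁻¹) atTop (𝓝 0) :=
      (tendsto_atTop_add_const_right _ _ h1).inv_tendsto_atTop
    have h3 : Tendsto (fun n : ℕ => ((n : ℝ) + α + 1)⁻¹) atTop (𝓝 0) :=
      (tendsto_atTop_add_const_right _ _
        (tendsto_atTop_add_const_right _ _ h1)).inv_tendsto_atTop
    simpa using h2.mul h3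
  have han := (FormalMultilinearSeries.ofScalars ℝ c).hasFPowerSeriesOnBall (by simp [hrad])
  have hsm : ContDiff ℝ ∞ (FormalMultilinearSeries.ofScalars ℝ c).sum := by
    rw [contDiff_iff_contDiffAt]
    intro x
    exact (han.analyticAt_of_mem (by simp [hrad])).contDiffAt
  have heq : tildeI α =
      fun z => (FormalMultilinearSeries.ofScalars ℝ c).sum ((z / 2) ^ 2) := by
    ext z
    have := FormalMultilinearSeries.ofScalars_sum_eq c ((z / 2) ^ 2)
    rw [FormalMultilinearSeries.ofScalarsSum] at this
    rw [this, tildeI]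
    refine tsum_congr fun n => ?_
    rw [smul_eq_mul, ← pow_mul, div_eq_mul_inv, mul_comm]
  rw [heq]
  exact hsm.comp (by fun_prop)

/-- Finite sums of products of a smooth function of `t`, a smooth function of `t·x/(1-t)`, a power
`xᵐ` and a moment of `K_α` of order at most `m` at `x/(1-t)`. -/
inductive BesselKProductSum (α : ℝ) : (ℝ → ℝ → ℝ) → Prop
  | term (c φ : ℝ → ℝ) (hc : ContDiffOn ℝ ∞ c (Iio 1)) (hφ : ContDiff ℝ ∞ φ) (p m : ℕ)
      (hp : p ≤ m) : BesselKProductSum α fun t x =>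
        x ^ m * (c t * φ (t * x / (1 - t)) * besselKMoment α p (x / (1 - t)))
  | add (f g : ℝ → ℝ → ℝ) : BesselKProductSum α f → BesselKProductSum α g →
      BesselKProductSum α fun t x => f t x + g t x

lemma BesselKProductSum.exists_hasDerivAt {α : ℝ} {f : ℝ → ℝ → ℝ} (hf : BesselKProductSum α f) :
    ∃ g, BesselKProductSum α g ∧
      ∀ x > 0, ∀ t < 1, HasDerivAt (fun t => f t x) (g t x) t := by
  induction hf with
  | add f₁ f₂ _ _ ih₁ ih₂ =>
    obtain ⟨g₁, hg₁, hd₁⟩ := ih₁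
    obtain ⟨g₂, hg₂, hd₂⟩ := ih₂
    exact ⟨_, .add _ _ hg₁ hg₂, fun x hx t ht => (hd₁ x hx t ht).add (hd₂ x hx t ht)⟩
  | term c φ hc hφ p m hp =>
    have hc' := (contDiffOn_infty_iff_deriv_of_isOpen isOpen_Iio).1 hc
    have hφ' := contDiff_infty_iff_deriv.1 hφ
    have hden : ContDiffOn ℝ ∞ (fun t : ℝ => c t / (1 - t) ^ 2) (Iio 1) :=
      hc.div (by fun_prop) fun t ht => pow_ne_zero _ (sub_ne_zero.2 (ne_of_gt ht))
    refine ⟨_, .add _ _ (.term _ φ hc'.2 hφ p m hp)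
      (.add _ _ (.term _ (deriv φ) hden hφ'.2 p (m + 1) (by lia))
        (.term _ φ hden.neg hφ (p + 1) (m + 1) (by lia))), fun x hx t ht => ?_⟩
    have ht0 : 1 - t ≠ 0 := by linarith
    have hcd : HasDerivAt c (deriv c t) t :=
      (hc'.1.differentiableAt (isOpen_Iio.mem_nhds ht)).hasDerivAt
    have h1 : HasDerivAt (fun t : ℝ => 1 - t) (-1) t := by
      simpa using (hasDerivAt_id t).const_sub 1
    have h2 : HasDerivAt (fun t => x / (1 - t)) (x / (1 - t) ^ 2) t :=
      ((hasDerivAt_const t x).div h1 ht0).congr_deriv (by ring)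
    have h3 : HasDerivAt (fun t => t * x / (1 - t)) (x / (1 - t) ^ 2) t :=
      (((hasDerivAt_id t).mul_const x).div h1 ht0).congr_deriv (by simp only [id]; ring)
    have h4 := (hφ'.1 (t * x / (1 - t))).hasDerivAt.comp t h3
    have h5 := (hasDerivAt_besselKMoment α p (div_pos hx (sub_pos.2 ht))).comp t h2
    refine (((hcd.mul h4).mul h5).const_mul (x ^ m)).congr_deriv ?_
    simp only [Function.comp, Pi.mul_apply]
    ring

lemma BesselKProductSum.exists_iteratedDeriv_eq {α : ℝ} {f : ℝ → ℝ → ℝ}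
    (hf : BesselKProductSum α f) (j : ℕ) :
    ∃ g, BesselKProductSum α g ∧
      ∀ x > 0, ∀ t < 1, iteratedDeriv j (fun t => f t x) t = g t x := by
  induction j with
  | zero => exact ⟨f, hf, fun x _ t _ => by simp⟩
  | succ j ih =>
    obtain ⟨g, hg, hfg⟩ := ih
    obtain ⟨g', hg', hd⟩ := hg.exists_hasDerivAt
    refine ⟨g', hg', fun x hx t ht => ?_⟩
    rw [iteratedDeriv_succ, ← (hd x hx t ht).deriv]
    refine EventuallyEq.deriv_eq ?_
    filter_upwards [isOpen_Iio.mem_nhds ht] with s hs using hfg x hx s hs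

lemma BesselKProductSum.continuousOn_and_le {α : ℝ} {f : ℝ → ℝ → ℝ} (hf : BesselKProductSum α f)
    {δ : ℝ} (hδ : 0 < δ) :
    ContinuousOn (f 0) (Ioi 0) ∧ ∃ C : ℝ, ∀ x > 0,
      |f 0 x| ≤ C * (x ^ (-(|α| + δ)) * Real.exp (-x / 2)) := by
  induction hf with
  | add f₁ f₂ _ _ ih₁ ih₂ =>
    obtain ⟨h₁, C₁, hC₁⟩ := ih₁
    obtain ⟨h₂, C₂, hC₂⟩ := ih₂
    refine ⟨h₁.add h₂, C₁ + C₂, fun x hx => ?_⟩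
    rw [add_mul]
    exact (abs_add_le _ _).trans (add_le_add (hC₁ x hx) (hC₂ x hx))
  | term c φ hc hφ p m hp =>
    obtain ⟨C, -, hb⟩ := exists_pow_mul_besselKMoment_le α hδ hp
    simp only [zero_mul, sub_zero, div_one]
    refine ⟨by have := continuousOn_besselKMoment α p; fun_prop, |c 0 * φ 0| * C,
      fun x hx => ?_⟩
    calc |x ^ m * (c 0 * φ 0 * besselKMoment α p x)|
        = |c 0 * φ 0| * (x ^ m * besselKMoment α p x) := by
          rw [abs_mul, abs_mul (c 0 * φ 0), abs_of_nonneg (besselKMoment_nonneg α p x),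
            abs_of_nonneg (pow_nonneg (le_of_lt hx) m)]
          ring
      _ ≤ |c 0 * φ 0| * (C * (x ^ (-(|α| + δ)) * Real.exp (-x / 2))) := by
          exact mul_le_mul_of_nonneg_left (hb x hx) (abs_nonneg _)
      _ = _ := by ring

lemma exists_genG₂_eq (μ ν : ℝ) (hμ : -2 < μ) :
    ∃ f, BesselKProductSum (ν / 2) f ∧
      ∀ x > 0, ∀ t < 1, genG₂ μ ν t x = x ^ (-(ν / 2)) * f t x := by
  refine ⟨_, .term (fun t => (1 - t) ^ (-(μ + ν + 2) / 2) * (2 * (1 - t)) ^ (ν / 2))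
    (tildeI (μ / 2)) ?_ (contDiff_tildeI (by linarith)) 0 0 le_rfl, fun x hx t ht => ?_⟩
  · refine ContDiffOn.mul (ContDiffOn.rpow_const_of_ne (by fun_prop) fun t ht => ?_)
      (ContDiffOn.rpow_const_of_ne (by fun_prop) fun t ht => ?_)
    · exact sub_ne_zero.2 (ne_of_gt ht)
    · exact mul_ne_zero two_ne_zero (sub_ne_zero.2 (ne_of_gt ht))
  · have ht0 : 0 < 1 - t := sub_pos.2 ht
    have h1 : (x / (1 - t) / 2) ^ (-(ν / 2)) = x ^ (-(ν / 2)) * (2 * (1 - t)) ^ (ν / 2) := by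
      rw [div_div, mul_comm (1 - t), Real.div_rpow (le_of_lt hx) (by positivity),
        Real.rpow_neg (by positivity : 0 ≤ 2 * (1 - t)), div_inv_eq_mul]
    simp only [genG₂, tildeK, h1, besselK, besselKMoment, pow_zero, mul_one]
    ring

/-- If `μ+ν > −2` and `μ−ν > −2` then `Λ_{2,j}^{μ,ν} ∈ L²((0,∞), x^{μ+ν+1}dx)`:
`∫₀^∞ |Λ_{2,j}^{μ,ν}(x)|²·x^{μ+ν+1} dx < ∞`. -/
theorem statement9 (μ ν : ℝ) (h₁ : -2 < μ + ν) (h₂ : -2 < μ - ν) (j : ℕ) :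
    IntegrableOn (fun x => Lambda₂ μ ν j x ^ 2 * x ^ (μ + ν + 1)) (Ioi (0 : ℝ)) := by

  set δ : ℝ := (μ + 2 - |ν|) / 4 with hδ
  have hν : |ν| < μ + 2 := abs_lt.2 ⟨by linarith, by linarith⟩
  have hδ0 : 0 < δ := by linarith
  obtain ⟨f, hf, hG⟩ := exists_genG₂_eq μ ν (by linarith)
  obtain ⟨g, hg, hfg⟩ := hf.exists_iteratedDeriv_eq j
  obtain ⟨hcont, C, hC⟩ := hg.continuousOn_and_le hδ0
  have hΛ : ∀ x ∈ Ioi (0 : ℝ),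
      Lambda₂ μ ν j x = x ^ (-(ν / 2)) * g 0 x / (j.factorial : ℝ) := by
    intro x hx
    have h : (fun t => genG₂ μ ν t x) =ᶠ[𝓝 0] fun t => x ^ (-(ν / 2)) * f t x := by
      filter_upwards [isOpen_Iio.mem_nhds (zero_lt_one : (0 : ℝ) < 1)] with t ht using hG x hx t ht
    rw [Lambda₂, h.iteratedDeriv_eq, iteratedDeriv_const_mul_field, hfg x hx 0 zero_lt_one]
  have hint : IntegrableOn (fun x : ℝ => (C / (j.factorial : ℝ)) ^ 2 *
      (x ^ (μ + 1 - |ν| - 2 * δ) * Real.exp (-1 * x ^ (1 : ℝ)))) (Ioi 0) :=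
    (integrableOn_rpow_mul_exp_neg_mul_rpow (by linarith) one_pos one_pos).const_mul _
  refine IntegrableOn.congr_fun (f := fun x : ℝ =>
    (x ^ (-(ν / 2)) * g 0 x / (j.factorial : ℝ)) ^ 2 * x ^ (μ + ν + 1)) ?_
    (fun x hx => by simp only [hΛ x hx]) measurableSet_Ioi
  refine hint.mono' ?_ ?_
  · refine ContinuousOn.aestronglyMeasurable ?_ measurableSet_Ioi
    have h (r : ℝ) : ContinuousOn (fun x : ℝ => x ^ r) (Ioi 0) :=
      continuousOn_id.rpow_const fun x hx => Or.inl (ne_of_gt hx)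
    exact ((((h _).mul hcont).div_const _).pow 2).mul (h _)
  · filter_upwards [ae_restrict_mem measurableSet_Ioi] with x hx
    have hx0 : 0 < x := hx
    rw [Real.norm_of_nonneg (by positivity)]
    have hsq : g 0 x ^ 2 ≤ (C * (x ^ (-(|ν / 2| + δ)) * Real.exp (-x / 2))) ^ 2 :=
      sq_le_sq' (neg_le_of_abs_le (hC x hx)) (le_of_abs_le (hC x hx))
    have hexp : Real.exp (-x / 2) ^ 2 = Real.exp (-1 * x ^ (1 : ℝ)) := by
      rw [← Real.exp_nat_mul, Real.rpow_one]; congr 1; push_cast; ring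
    have hpow : (x ^ (-(ν / 2))) ^ 2 * (x ^ (-(|ν / 2| + δ))) ^ 2 * x ^ (μ + ν + 1) =
        x ^ (μ + 1 - |ν| - 2 * δ) := by
      rw [← Real.rpow_mul_natCast hx0.le, ← Real.rpow_mul_natCast hx0.le, ← Real.rpow_add hx0,
        ← Real.rpow_add hx0, abs_div, abs_two]
      congr 1; push_cast; ring
    calc (x ^ (-(ν / 2)) * g 0 x / (j.factorial : ℝ)) ^ 2 * x ^ (μ + ν + 1)
        = (x ^ (-(ν / 2)) / (j.factorial : ℝ)) ^ 2 * x ^ (μ + ν + 1) * g 0 x ^ 2 := by ring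
      _ ≤ (x ^ (-(ν / 2)) / (j.factorial : ℝ)) ^ 2 * x ^ (μ + ν + 1) *
          (C * (x ^ (-(|ν / 2| + δ)) * Real.exp (-x / 2))) ^ 2 := by gcongr
      _ = (C / (j.factorial : ℝ)) ^ 2 * ((x ^ (-(ν / 2))) ^ 2 * (x ^ (-(|ν / 2| + δ))) ^ 2 *
          x ^ (μ + ν + 1) * Real.exp (-x / 2) ^ 2) := by ring
      _ = _ := by rw [hpow, hexp]
end
end

section
/- Let μ, ν ∈ ℝ with μ > −1 and ν > −1, let j ∈ ℕ₀ and x > 0. Then Λ_{1,j}^{μ,ν}(x) = (π·Γ((μ+1)/2)·Γ((ν+1)/2))^{−1}·∫_0^π ∫_0^π e^{−x·cos φ}·L_j^{(μ+ν)/2}(x(cos θ + cos φ))·(sin θ)^μ·(sin φ)^ν dφ dθ, and Λ_{2,j}^{μ,ν}(x) = (Γ((μ+1)/2)·Γ((ν+1)/2))^{−1}·∫_0^π ∫_0^∞ e^{−x·cosh φ}·L_j^{(μ+ν)/2}(x(cos θ + cosh φ))·(sin θ)^μ·(sinh φ)^ν dφ dθ. -/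
noncomputable section

open Set MeasureTheory Filter Topology

/-- The Laguerre polynomial
`Lₙ^α(z) = ((α+1)ₙ/n!)·Σ_{k=0}^n binom(n,k)·((−1)^k/(α+1)ₖ)·z^k`. -/
def laguerreL (n : ℕ) (α : ℝ) (z : ℝ) : ℝ :=
  (ascPochhammer ℝ n).eval (α + 1) / (n.factorial : ℝ) *
    ∑ k ∈ Finset.range (n + 1),
      (n.choose k : ℝ) * ((-1) ^ k / (ascPochhammer ℝ k).eval (α + 1)) * z ^ k

theorem hasSum_ascPochhammer_mul_pow (a : ℝ) {t : ℝ} (ht : |t| < 1) :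
    HasSum (fun n : ℕ => (ascPochhammer ℝ n).eval a / (n.factorial : ℝ) * t ^ n)
      ((1 - t) ^ (-a)) := by
  have h := (Real.one_div_one_sub_rpow_hasFPowerSeriesOnBall_zero a).hasSum (y := t)
    (by simpa [enorm_eq_nnnorm, ← NNReal.coe_lt_coe] using ht)
  have h1 : 0 ≤ 1 - t := by linarith [(abs_lt.mp ht).2]
  rw [zero_add, one_div, ← Real.rpow_neg h1] at h
  refine h.congr_fun fun n => ?_
  have := Ring.factorial_nsmul_multichoose_eq_ascPochhammer a n
  rw [Polynomial.ascPochhammer_smeval_eq_eval, Ring.multichoose_eq, nsmul_eq_mul] at this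
  rw [← this]
  have hn : (n.factorial : ℝ) ≠ 0 := by positivity
  rw [mul_div_cancel_left₀ _ hn]
  simp [FormalMultilinearSeries.ofScalars]

theorem HasSum.antidiagonal {f : ℕ × ℕ → ℝ} {g : ℕ → ℝ} {S : ℝ} (hf : Summable f)
    (hg : ∀ k, HasSum (fun m => f (k, m)) (g k)) (hS : HasSum g S) :
    HasSum (fun n => ∑ p ∈ Finset.HasAntidiagonal.antidiagonal n, f p) S := by
  have h1 : HasSum f S := by
    have := hf.hasSum.prod_fiberwise hg
    rw [← this.unique hS]
    exact hf.hasSum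
  rw [← Finset.HasAntidiagonal.sigmaAntidiagonalEquivProd.hasSum_iff] at h1
  have := h1.sigma (fun n => (hasSum_fintype _))
  refine this.congr_fun fun n => ?_
  exact (Finset.sum_coe_sort (Finset.HasAntidiagonal.antidiagonal n) f).symm

theorem ascPochhammer_eval_add (a : ℝ) (k m : ℕ) :
    (ascPochhammer ℝ (k + m)).eval a
      = (ascPochhammer ℝ k).eval a * (ascPochhammer ℝ m).eval (a + k) := by
  rw [← ascPochhammer_mul]
  simp

theorem laguerreL_eq_sum_antidiagonal {α : ℝ} (hα : -1 < α) (n : ℕ) (y : ℝ) :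
    laguerreL n α y = ∑ p ∈ Finset.HasAntidiagonal.antidiagonal n, (-y) ^ p.1 / (p.1.factorial : ℝ) *
      ((ascPochhammer ℝ p.2).eval (α + 1 + p.1) / (p.2.factorial : ℝ)) := by
  rw [Finset.Nat.sum_antidiagonal_eq_sum_range_succ_mk, laguerreL, Finset.mul_sum]
  refine Finset.sum_congr rfl fun k hk => ?_
  have hkn : k ≤ n := by simpa [Nat.lt_succ_iff] using hk
  obtain ⟨m, rfl⟩ := Nat.exists_eq_add_of_le hkn
  have hk0 : (ascPochhammer ℝ k).eval (α + 1) ≠ 0 := (ascPochhammer_pos k _ (by linarith)).ne'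
  rw [ascPochhammer_eval_add, Nat.add_sub_cancel_left, Nat.cast_add_choose, neg_pow y]
  have h1 : ((k + m).factorial : ℝ) ≠ 0 := by positivity
  have h2 : (k.factorial : ℝ) ≠ 0 := by positivity
  have h3 : (m.factorial : ℝ) ≠ 0 := by positivity
  field_simp

theorem abs_laguerreL_le {α : ℝ} (hα : -1 < α) (n : ℕ) (y : ℝ) :
    |laguerreL n α y| ≤ laguerreL n α (-|y|) := by
  rw [laguerreL_eq_sum_antidiagonal hα, laguerreL_eq_sum_antidiagonal hα]
  refine (Finset.abs_sum_le_sum_abs _ _).trans (Finset.sum_le_sum fun p _ => ?_)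
  have h := ascPochhammer_pos p.2 (α + 1 + p.1) (by linarith [p.1.cast_nonneg (α := ℝ)])
  rw [abs_mul, abs_div, abs_pow, abs_neg, neg_neg, Nat.abs_cast,
    abs_of_nonneg (a := _ / _) (by positivity)]

theorem continuous_laguerreL (n : ℕ) (α : ℝ) : Continuous (laguerreL n α) := by
  unfold laguerreL
  fun_prop

theorem hasSum_exp_div_factorial (z : ℝ) :
    HasSum (fun k : ℕ => z ^ k / (k.factorial : ℝ)) (Real.exp z) := by
  rw [Real.exp_eq_exp_ℝ]
  exact NormedSpace.expSeries_div_hasSum_exp z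

theorem hasSum_laguerreL {α : ℝ} (hα : -1 < α) {t : ℝ} (ht : |t| < 1) (y : ℝ) :
    HasSum (fun n => laguerreL n α y * t ^ n)
      ((1 - t) ^ (-(α + 1)) * Real.exp (-(t * y) / (1 - t))) := by
  have key : ∀ (t y : ℝ), |t| < 1 →
      (∀ k : ℕ, HasSum (fun m : ℕ => (-(t * y)) ^ k / (k.factorial : ℝ) *
        ((ascPochhammer ℝ m).eval (α + 1 + k) / (m.factorial : ℝ) * t ^ m))
        ((-(t * y)) ^ k / (k.factorial : ℝ) * (1 - t) ^ (-(α + 1 + k)))) ∧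
      HasSum (fun k : ℕ => (-(t * y)) ^ k / (k.factorial : ℝ) * (1 - t) ^ (-(α + 1 + k)))
        ((1 - t) ^ (-(α + 1)) * Real.exp (-(t * y) / (1 - t))) := by
    intro t y ht
    have h1 : 0 < 1 - t := by linarith [(abs_lt.mp ht).2]
    refine ⟨fun k => (hasSum_ascPochhammer_mul_pow _ ht).mul_left _, ?_⟩
    refine HasSum.congr_fun ((hasSum_exp_div_factorial (-(t * y) / (1 - t))).mul_left
      ((1 - t) ^ (-(α + 1)))) fun k => ?_
    rw [neg_add (α + 1), Real.rpow_add h1, Real.rpow_neg h1.le (k : ℝ), Real.rpow_natCast, div_pow]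
    ring
  have hsum : Summable (fun p : ℕ × ℕ => (-(t * y)) ^ p.1 / (p.1.factorial : ℝ) *
        ((ascPochhammer ℝ p.2).eval (α + 1 + p.1) / (p.2.factorial : ℝ) * t ^ p.2)) := by
    have habs : |(|t|)| < 1 := by rwa [abs_abs]
    obtain ⟨ha, hb⟩ := key |t| (-|y|) habs
    have hpos : ∀ p : ℕ × ℕ, 0 < (ascPochhammer ℝ p.2).eval (α + 1 + p.1) := fun p =>
      ascPochhammer_pos p.2 (α + 1 + p.1) (by linarith [p.1.cast_nonneg (α := ℝ)])
    have : Summable (fun p : ℕ × ℕ => (-(|t| * -|y|)) ^ p.1 / (p.1.factorial : ℝ) *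
        ((ascPochhammer ℝ p.2).eval (α + 1 + p.1) / (p.2.factorial : ℝ) * |t| ^ p.2)) := by
      rw [summable_prod_of_nonneg]
      · refine ⟨fun k => (ha k).summable, ?_⟩
        simp only [fun k => (ha k).tsum_eq]
        exact hb.summable
      · intro p
        have := hpos p
        simp only [mul_neg, neg_neg, Pi.zero_apply]
        positivity
    refine this.of_norm_bounded fun p => le_of_eq ?_
    have := hpos p
    rw [Real.norm_eq_abs, abs_mul, abs_mul, abs_div, abs_div, abs_pow, abs_pow, abs_neg, abs_mul,
      abs_of_pos this]
    simp
  obtain ⟨ha, hb⟩ := key t y ht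
  refine (HasSum.antidiagonal hsum ha hb).congr_fun fun n => ?_
  rw [laguerreL_eq_sum_antidiagonal hα, Finset.sum_mul]
  refine Finset.sum_congr rfl fun p hp => ?_
  rw [← Finset.HasAntidiagonal.mem_antidiagonal.mp hp, pow_add, neg_mul_eq_mul_neg, mul_pow]
  ring

theorem iteratedDeriv_div_factorial_of_hasSum {a : ℕ → ℝ} {g : ℝ → ℝ} {r : ℝ} (hr : 0 < r)
    (h : ∀ t, |t| < r → HasSum (fun n => a n * t ^ n) (g t)) (j : ℕ) :
    iteratedDeriv j g 0 / (j.factorial : ℝ) = a j := by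
  have hp : HasFPowerSeriesAt g (FormalMultilinearSeries.ofScalars ℝ a) 0 := by
    rw [hasFPowerSeriesAt_iff]
    filter_upwards [Metric.ball_mem_nhds (0 : ℝ) hr] with t ht
    have := h t (by simpa using ht)
    simpa [FormalMultilinearSeries.coeff_ofScalars, mul_comm] using this
  have := hp.analyticAt.hasFPowerSeriesAt.eq_formalMultilinearSeries hp
  exact congrFun ((FormalMultilinearSeries.ofScalars_series_eq_iff (E := ℝ) _ _).mp this) j

section LaguerreIntegral

variable {A : Type*} [MeasurableSpace A] {M : Measure A} {w y : A → ℝ}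

theorem hasSum_abs_mul_laguerreL {α : ℝ} (hα : -1 < α) {t : ℝ} (ht : |t| < 1) (b z : ℝ) :
    HasSum (fun n => |b| * laguerreL n α (-|z|) * |t| ^ n)
      (|b| * ((1 - |t|) ^ (-(α + 1)) * Real.exp (|t| / (1 - |t|) * |z|))) := by
  have := (hasSum_laguerreL hα (t := |t|) (by rwa [abs_abs]) (-|z|)).mul_left |b|
  have e : |t| / (1 - |t|) * |z| = -(|t| * -|z|) / (1 - |t|) := by ring
  rw [e]
  simpa only [mul_assoc] using this

theorem integrable_abs_mul_rpow_mul_exp (α : ℝ) (hw : AEStronglyMeasurable w M)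
    (hy : AEStronglyMeasurable y M) (hi : Integrable (fun a => |w a| * Real.exp (|y a| / 2)) M)
    {t : ℝ} (ht : |t| ≤ 1 / 3) :
    Integrable (fun a => |w a| * ((1 - |t|) ^ (-(α + 1)) *
      Real.exp (|t| / (1 - |t|) * |y a|))) M := by
  refine (hi.const_mul ((1 - |t|) ^ (-(α + 1)))).mono ?_ (ae_of_all _ fun a => ?_)
  · exact hw.norm.mul (((Real.continuous_exp.comp_aestronglyMeasurable
      (hy.norm.const_mul _))).const_mul _)
  · have h1 : 0 < 1 - |t| := by linarith
    have h2 : |t| / (1 - |t|) ≤ 1 / 2 := by rw [div_le_iff₀ h1]; linarith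
    rw [Real.norm_of_nonneg (by positivity), Real.norm_of_nonneg (by positivity), mul_left_comm]
    have h3 : |t| / (1 - |t|) * |y a| ≤ |y a| / 2 := by nlinarith [abs_nonneg (y a)]
    gcongr

theorem integrable_mul_laguerreL {α : ℝ} (hα : -1 < α) (hw : AEStronglyMeasurable w M)
    (hy : AEStronglyMeasurable y M) (hi : Integrable (fun a => |w a| * Real.exp (|y a| / 2)) M)
    (n : ℕ) : Integrable (fun a => w a * laguerreL n α (y a)) M := by
  have ht : |(1 / 3 : ℝ)| = 1 / 3 := abs_of_pos (by norm_num)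
  refine ((integrable_abs_mul_rpow_mul_exp α hw hy hi ht.le).const_mul (3 ^ n)).mono
    (hw.mul ((continuous_laguerreL n α).comp_aestronglyMeasurable hy)) (ae_of_all _ fun a => ?_)
  have hs := hasSum_abs_mul_laguerreL hα (t := 1 / 3) (by rw [ht]; norm_num) (w a) (y a)
  have hnn : ∀ k, 0 ≤ laguerreL k α (-|y a|) := fun k =>
    (abs_nonneg _).trans (abs_laguerreL_le hα k (y a))
  have hle := le_hasSum hs n fun k _ => mul_nonneg (mul_nonneg (abs_nonneg _) (hnn k)) (by positivity)
  rw [norm_mul, Real.norm_eq_abs, Real.norm_eq_abs]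
  refine le_trans ?_ (le_abs_self _)
  calc |w a| * |laguerreL n α (y a)| ≤ |w a| * laguerreL n α (-|y a|) := by
        gcongr
        exact abs_laguerreL_le hα n _
    _ = 3 ^ n * (|w a| * laguerreL n α (-|y a|) * |1 / 3| ^ n) := by
        rw [ht, one_div, inv_pow]
        field_simp
    _ ≤ _ := by gcongr

theorem hasSum_integral_mul_laguerreL {α : ℝ} (hα : -1 < α) (hw : AEStronglyMeasurable w M)
    (hy : AEStronglyMeasurable y M) (hi : Integrable (fun a => |w a| * Real.exp (|y a| / 2)) M)
    {t : ℝ} (ht : |t| ≤ 1 / 3) :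
    HasSum (fun n => (∫ a, w a * laguerreL n α (y a) ∂M) * t ^ n)
      (∫ a, w a * ((1 - t) ^ (-(α + 1)) * Real.exp (-(t * y a) / (1 - t))) ∂M) := by
  have ht1 : |t| < 1 := by linarith
  have hs := fun a => hasSum_abs_mul_laguerreL hα ht1 (w a) (y a)
  have := hasSum_integral_of_dominated_convergence (μ := M)
    (F := fun n a => w a * laguerreL n α (y a) * t ^ n)
    (f := fun a => w a * ((1 - t) ^ (-(α + 1)) * Real.exp (-(t * y a) / (1 - t))))
    (fun n a => |w a| * laguerreL n α (-|y a|) * |t| ^ n)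
    (fun n => (integrable_mul_laguerreL hα hw hy hi n).1.mul_const _)
    (fun n => ae_of_all _ fun a => ?_) (ae_of_all _ fun a => (hs a).summable)
    (by simpa only [(hs _).tsum_eq] using integrable_abs_mul_rpow_mul_exp α hw hy hi ht)
    (ae_of_all _ fun a => ?_)
  · simpa only [integral_mul_const] using this
  · rw [norm_mul, norm_mul, norm_pow, Real.norm_eq_abs, Real.norm_eq_abs, Real.norm_eq_abs]
    gcongr
    exact abs_laguerreL_le hα n _
  · simpa only [mul_assoc] using (hasSum_laguerreL hα ht1 (y a)).mul_left (w a)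

end LaguerreIntegral

theorem hasSum_integral_integral_laguerreL {α : ℝ} (hα : -1 < α) {x : ℝ} (hx : 0 < x)
    {m₁ m₂ : Measure ℝ} [SFinite m₁] [SFinite m₂] {f g c : ℝ → ℝ} (hf : Integrable f m₁)
    (hc : Continuous c) (hg : AEStronglyMeasurable g m₂)
    (hcg : Integrable (fun p => Real.exp (-x * c p) * |g p| * Real.exp (x * |c p| / 2)) m₂)
    {s : ℝ} (hs : |s| ≤ 1 / 3) :
    HasSum (fun n => (∫ t, ∫ p, Real.exp (-x * c p) * laguerreL n α (x * (Real.cos t + c p)) *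
        f t * g p ∂m₂ ∂m₁) * s ^ n)
      ((1 - s) ^ (-(α + 1)) * (∫ t, Real.exp (-(s * x / (1 - s)) * Real.cos t) * f t ∂m₁) *
        ∫ p, Real.exp (-(x / (1 - s)) * c p) * g p ∂m₂) := by
  have hw : AEStronglyMeasurable (fun q : ℝ × ℝ => f q.1 * (Real.exp (-x * c q.2) * g q.2))
      (m₁.prod m₂) :=
    hf.1.comp_fst.mul (((by fun_prop : Continuous fun p => Real.exp (-x * c p)).aestronglyMeasurable
      |>.mul hg).comp_snd)
  have hy : AEStronglyMeasurable (fun q : ℝ × ℝ => x * (Real.cos q.1 + c q.2)) (m₁.prod m₂) :=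
    (by fun_prop : Continuous _).aestronglyMeasurable
  have hi : Integrable (fun q : ℝ × ℝ => |f q.1 * (Real.exp (-x * c q.2) * g q.2)| *
      Real.exp (|x * (Real.cos q.1 + c q.2)| / 2)) (m₁.prod m₂) := by
    refine ((hf.norm.mul_prod hcg).const_mul (Real.exp (x / 2))).mono
      (hw.norm.mul (by fun_prop : Continuous _).aestronglyMeasurable) (ae_of_all _ fun q => ?_)
    rw [Real.norm_of_nonneg (by positivity), Real.norm_of_nonneg (by positivity), abs_mul,
      abs_mul, Real.abs_exp, Real.norm_eq_abs]
    have h1 : |x * (Real.cos q.1 + c q.2)| / 2 ≤ x / 2 + x * |c q.2| / 2 := by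
      rw [abs_mul, abs_of_pos hx]
      have h2 := abs_add_le (Real.cos q.1) (c q.2)
      have h3 := Real.abs_cos_le_one q.1
      nlinarith
    calc _ ≤ |f q.1| * (Real.exp (-x * c q.2) * |g q.2|) *
          Real.exp (x / 2 + x * |c q.2| / 2) := by gcongr
      _ = _ := by rw [Real.exp_add]; ring
  have h := hasSum_integral_mul_laguerreL hα hw hy hi hs
  have hs1 : 1 - s ≠ 0 := by have := (abs_le.mp hs).2; linarith
  convert h.congr_fun fun n => ?_ using 1
  · rw [mul_assoc, ← integral_prod_mul, ← integral_const_mul]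
    refine integral_congr_ae (ae_of_all _ fun q => ?_)
    have : Real.exp (-(s * x / (1 - s)) * Real.cos q.1) * Real.exp (-(x / (1 - s)) * c q.2)
        = Real.exp (-x * c q.2) * Real.exp (-(s * (x * (Real.cos q.1 + c q.2))) / (1 - s)) := by
      rw [← Real.exp_add, ← Real.exp_add]
      congr 1
      field_simp
      ring
    linear_combination (1 - s) ^ (-(α + 1)) * f q.1 * g q.2 * this
  · rw [integral_prod _ (integrable_mul_laguerreL hα hw hy hi n)]
    congr 1
    refine integral_congr_ae (ae_of_all _ fun t => integral_congr_ae (ae_of_all _ fun p => ?_))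
    ring

theorem integrableOn_and_integral_rpow_mul_one_sub_rpow {a b : ℝ} (ha : 0 < a) (hb : 0 < b) :
    IntegrableOn (fun u : ℝ => u ^ (a - 1) * (1 - u) ^ (b - 1)) (Ioo 0 1) ∧
    ∫ u in Ioo (0 : ℝ) 1, u ^ (a - 1) * (1 - u) ^ (b - 1)
      = Real.Gamma a * Real.Gamma b / Real.Gamma (a + b) := by
  have hc := (intervalIntegrable_iff_integrableOn_Ioo_of_le zero_le_one).mp
    (Complex.betaIntegral_convergent (u := a) (v := b) (by simpa) (by simpa))
  have heq : EqOn (fun x : ℝ => (x : ℂ) ^ ((a : ℂ) - 1) * (1 - (x : ℂ)) ^ ((b : ℂ) - 1))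
      (fun x : ℝ => ((x ^ (a - 1) * (1 - x) ^ (b - 1) : ℝ) : ℂ)) (Ioo 0 1) := by
    intro u hu
    have h1 : 0 ≤ 1 - u := by linarith [hu.2]
    simp only
    rw [Complex.ofReal_mul, Complex.ofReal_cpow hu.1.le, Complex.ofReal_cpow h1]
    simp
  refine ⟨((hc.congr_fun heq measurableSet_Ioo).re).congr (ae_of_all _ fun u => by simp), ?_⟩
  have h := Complex.Gamma_mul_Gamma_eq_betaIntegral (s := a) (t := b) (by simpa) (by simpa)
  rw [Complex.betaIntegral, intervalIntegral.integral_of_le zero_le_one,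
    integral_Ioc_eq_integral_Ioo, setIntegral_congr_fun measurableSet_Ioo heq, integral_complex_ofReal,
    Complex.Gamma_ofReal, Complex.Gamma_ofReal, ← Complex.ofReal_add, Complex.Gamma_ofReal] at h
  rw [eq_div_iff (Real.Gamma_pos_of_pos (by linarith)).ne', mul_comm]
  exact_mod_cast h.symm

theorem integrableOn_and_integral_sin_rpow {μ : ℝ} (hμ : -1 < μ) :
    IntegrableOn (fun t => Real.sin t ^ μ) (Ioo 0 Real.pi) ∧
    ∫ t in Ioo (0 : ℝ) Real.pi, Real.sin t ^ μ
      = Real.sqrt Real.pi * Real.Gamma ((μ + 1) / 2) / Real.Gamma (μ / 2 + 1) := by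
  have ha : 0 < (μ + 1) / 2 := by linarith
  obtain ⟨hi, he⟩ := integrableOn_and_integral_rpow_mul_one_sub_rpow ha ha
  have himg : (fun t => (1 - Real.cos t) / 2) '' Ioo 0 Real.pi = Ioo 0 1 := by
    ext u
    simp only [mem_image, mem_Ioo]
    constructor
    · rintro ⟨t, ht, rfl⟩
      have hs := Real.sin_pos_of_pos_of_lt_pi ht.1 ht.2
      have hsq := Real.sin_sq_add_cos_sq t
      constructor <;> nlinarith
    · rintro ⟨h0, h1⟩
      refine ⟨Real.arccos (1 - 2 * u), ⟨Real.arccos_pos.mpr (by linarith), ?_⟩, ?_⟩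
      · refine lt_of_le_of_ne (Real.arccos_le_pi _) fun h => ?_
        rw [Real.arccos_eq_pi] at h
        linarith
      · rw [Real.cos_arccos (by linarith) (by linarith)]
        ring
  have hder : ∀ t ∈ Ioo 0 Real.pi, HasDerivWithinAt (fun t => (1 - Real.cos t) / 2)
      (Real.sin t / 2) (Ioo 0 Real.pi) t := fun t _ => by
    simpa using (((Real.hasDerivAt_cos t).const_sub 1).div_const 2).hasDerivWithinAt
  have hinj : InjOn (fun t => (1 - Real.cos t) / 2) (Ioo 0 Real.pi) := fun t ht t' ht' h =>
    Real.injOn_cos (Ioo_subset_Icc_self ht) (Ioo_subset_Icc_self ht') (by simp only at h; linarith)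
  have hfun : EqOn (fun t => |Real.sin t / 2| • (((1 - Real.cos t) / 2) ^ ((μ + 1) / 2 - 1) *
      (1 - (1 - Real.cos t) / 2) ^ ((μ + 1) / 2 - 1)))
      (fun t => 2 ^ (-μ) * Real.sin t ^ μ) (Ioo 0 Real.pi) := by
    intro t ht
    have hs := Real.sin_pos_of_pos_of_lt_pi ht.1 ht.2
    have hc1 := Real.neg_one_le_cos t
    have hc2 := Real.cos_le_one t
    simp only [smul_eq_mul]
    rw [← Real.mul_rpow (by linarith) (by linarith), abs_of_pos (by positivity),
      show (1 - Real.cos t) / 2 * (1 - (1 - Real.cos t) / 2) = (Real.sin t / 2) ^ (2 : ℝ) by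
        rw [Real.rpow_two]; linear_combination -(Real.sin_sq_add_cos_sq t) / 4,
      ← Real.rpow_mul (by positivity)]
    conv_lhs => rw [← Real.rpow_one (Real.sin t / 2), ← Real.rpow_mul (by positivity),
      ← Real.rpow_add (by positivity)]
    rw [show 1 + 1 * (2 * ((μ + 1) / 2 - 1)) = μ by ring, Real.div_rpow hs.le (by norm_num),
      Real.rpow_neg (by norm_num)]
    field_simp
  have h2 : (2 : ℝ) ^ (-μ) ≠ 0 := by positivity
  rw [← himg, integrableOn_image_iff_integrableOn_abs_deriv_smul measurableSet_Ioo hder hinj,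
    integrableOn_congr_fun hfun measurableSet_Ioo] at hi
  rw [← himg, integral_image_eq_integral_abs_deriv_smul measurableSet_Ioo hder hinj,
    setIntegral_congr_fun measurableSet_Ioo hfun, integral_const_mul] at he
  refine ⟨(integrable_const_mul_iff (isUnit_iff_ne_zero.mpr h2) _).mp hi, ?_⟩
  have hd := Real.Gamma_mul_Gamma_add_half ((μ + 1) / 2)
  have hg1 := (Real.Gamma_pos_of_pos ha).ne'
  have hg2 := (Real.Gamma_pos_of_pos (show 0 < μ / 2 + 1 by linarith)).ne'
  have hg3 := (Real.Gamma_pos_of_pos (show 0 < μ + 1 by linarith)).ne'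
  rw [show (μ + 1) / 2 + 1 / 2 = μ / 2 + 1 by ring, show 2 * ((μ + 1) / 2) = μ + 1 by ring,
    show 1 - (μ + 1) = -μ by ring] at hd
  rw [show (μ + 1) / 2 + (μ + 1) / 2 = μ + 1 by ring, eq_div_iff hg3] at he
  rw [eq_div_iff hg2]
  refine mul_left_cancel₀ (mul_ne_zero (mul_ne_zero h2 hg1) hg3) ?_
  linear_combination Real.Gamma (μ / 2 + 1) * Real.Gamma ((μ + 1) / 2) * he
    + Real.Gamma ((μ + 1) / 2) ^ 2 * hd

theorem integrableOn_continuous_mul_sin_rpow {μ : ℝ} (hμ : -1 < μ) {h : ℝ → ℝ}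
    (hh : Continuous h) : IntegrableOn (fun t => h t * Real.sin t ^ μ) (Ioo 0 Real.pi) := by
  have h := (integrableOn_and_integral_sin_rpow hμ).1
  rw [← integrableOn_Icc_iff_integrableOn_Ioo] at h ⊢
  exact IntegrableOn.continuousOn_mul hh.continuousOn h isCompact_Icc

theorem integral_cos_pow_mul_sin_rpow (n : ℕ) {μ : ℝ} (hμ : -1 < μ) :
    ∫ t in Ioo (0 : ℝ) Real.pi, Real.cos t ^ (2 * n) * Real.sin t ^ μ
      = Real.Gamma (n + 1 / 2) * Real.Gamma ((μ + 1) / 2) / Real.Gamma (n + μ / 2 + 1) := by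
  induction n generalizing μ with
  | zero =>
    simpa [Real.Gamma_one_half_eq, -one_div] using (integrableOn_and_integral_sin_rpow hμ).2
  | succ n ih =>
    have hμ2 : -1 < μ + 2 := by linarith
    have hstep : ∫ t in Ioo (0 : ℝ) Real.pi, Real.cos t ^ (2 * (n + 1)) * Real.sin t ^ μ
        = (∫ t in Ioo (0 : ℝ) Real.pi, Real.cos t ^ (2 * n) * Real.sin t ^ μ)
          - ∫ t in Ioo (0 : ℝ) Real.pi, Real.cos t ^ (2 * n) * Real.sin t ^ (μ + 2) := by
      rw [← integral_sub (integrableOn_continuous_mul_sin_rpow hμ (by fun_prop))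
        (integrableOn_continuous_mul_sin_rpow hμ2 (by fun_prop))]
      refine setIntegral_congr_fun measurableSet_Ioo fun t ht => ?_
      have hs := Real.sin_pos_of_pos_of_lt_pi ht.1 ht.2
      rw [Real.rpow_add hs, Real.rpow_two]
      linear_combination Real.cos t ^ (2 * n) * Real.sin t ^ μ * Real.sin_sq_add_cos_sq t
    have hn : (0 : ℝ) ≤ n := n.cast_nonneg
    have h1 := Real.Gamma_add_one (s := (n : ℝ) + 1 / 2) (by positivity)
    have h2 := Real.Gamma_add_one (s := (μ + 1) / 2) (by linarith)
    have h3 := Real.Gamma_add_one (s := (n : ℝ) + μ / 2 + 1) (by linarith)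
    have hg := (Real.Gamma_pos_of_pos (show 0 < (n : ℝ) + μ / 2 + 1 by linarith)).ne'
    have hn0 : (n : ℝ) + μ / 2 + 1 ≠ 0 := by linarith
    rw [hstep, ih hμ, ih hμ2, show (μ + 2 + 1) / 2 = (μ + 1) / 2 + 1 by ring,
      show (n : ℝ) + (μ + 2) / 2 + 1 = n + μ / 2 + 1 + 1 by ring, Nat.cast_succ,
      show (n : ℝ) + 1 + 1 / 2 = n + 1 / 2 + 1 by ring,
      show (n : ℝ) + 1 + μ / 2 + 1 = n + μ / 2 + 1 + 1 by ring, h1, h2, h3,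
      div_sub_div _ _ hg (mul_ne_zero hn0 hg),
      div_eq_div_iff (mul_ne_zero hg (mul_ne_zero hn0 hg)) (mul_ne_zero hn0 hg)]
    ring

theorem integral_exp_cos_mul_sin_rpow {μ : ℝ} (hμ : -1 < μ) (z : ℝ) :
    ∫ t in Ioo (0 : ℝ) Real.pi, Real.exp (-z * Real.cos t) * Real.sin t ^ μ
      = Real.sqrt Real.pi * Real.Gamma ((μ + 1) / 2) * tildeI (μ / 2) z := by
  have hrefl : ∫ t in Ioo (0 : ℝ) Real.pi, Real.exp (-z * Real.cos t) * Real.sin t ^ μ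
      = ∫ t in Ioo (0 : ℝ) Real.pi, Real.exp (z * Real.cos t) * Real.sin t ^ μ := by
    have := intervalIntegral.integral_comp_sub_left
      (fun t => Real.exp (z * Real.cos t) * Real.sin t ^ μ) Real.pi (a := 0) (b := Real.pi)
    simpa [intervalIntegral.integral_of_le Real.pi_pos.le, integral_Ioc_eq_integral_Ioo] using this
  have hcosh : ∫ t in Ioo (0 : ℝ) Real.pi, Real.exp (-z * Real.cos t) * Real.sin t ^ μ
      = ∫ t in Ioo (0 : ℝ) Real.pi, Real.cosh (z * Real.cos t) * Real.sin t ^ μ := by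
    have hadd := integral_add (integrableOn_continuous_mul_sin_rpow hμ
        (h := fun t => Real.exp (z * Real.cos t)) (by fun_prop))
      (integrableOn_continuous_mul_sin_rpow hμ
        (h := fun t => Real.exp (-z * Real.cos t)) (by fun_prop))
    rw [← hrefl, ← two_mul] at hadd
    rw [← mul_right_inj' (two_ne_zero' ℝ), ← hadd, ← integral_const_mul]
    refine integral_congr_ae (ae_of_all _ fun t => ?_)
    simp only [Real.cosh_eq, neg_mul]
    ring
  have hF : ∀ t, HasSum (fun n : ℕ => (z * Real.cos t) ^ (2 * n) / ((2 * n).factorial : ℝ) *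
      Real.sin t ^ μ) (Real.cosh (z * Real.cos t) * Real.sin t ^ μ) :=
    fun t => (Real.hasSum_cosh (z * Real.cos t)).mul_right _
  have hb : ∀ t, HasSum (fun n : ℕ => z ^ (2 * n) / ((2 * n).factorial : ℝ) * |Real.sin t ^ μ|)
      (Real.cosh z * |Real.sin t ^ μ|) := fun t => (Real.hasSum_cosh z).mul_right _
  have hsum := hasSum_integral_of_dominated_convergence (μ := volume.restrict (Ioo 0 Real.pi))
    (fun (n : ℕ) t => z ^ (2 * n) / ((2 * n).factorial : ℝ) * |Real.sin t ^ μ|)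
    (fun n => (integrableOn_continuous_mul_sin_rpow hμ
      (h := fun t => (z * Real.cos t) ^ (2 * n) / ((2 * n).factorial : ℝ)) (by fun_prop)).1)
    (fun n => ae_of_all _ fun t => ?_) (ae_of_all _ fun t => (hb t).summable)
    (by
      simp only [fun t => (hb t).tsum_eq]
      exact (integrableOn_and_integral_sin_rpow hμ).1.abs.const_mul _)
    (ae_of_all _ hF)
  · rw [hcosh, ← hsum.tsum_eq, tildeI, ← tsum_mul_left]
    refine tsum_congr fun n => ?_
    have : ∀ t, (z * Real.cos t) ^ (2 * n) / ((2 * n).factorial : ℝ) * Real.sin t ^ μ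
        = z ^ (2 * n) / ((2 * n).factorial : ℝ) * (Real.cos t ^ (2 * n) * Real.sin t ^ μ) :=
      fun t => by ring
    simp only [this]
    rw [integral_const_mul, integral_cos_pow_mul_sin_rpow n hμ]
    have hd := Real.Gamma_mul_Gamma_add_half (n + 1 / 2 : ℝ)
    rw [add_assoc, add_halves, show 2 * ((n : ℝ) + 1 / 2) = ((2 * n : ℕ) : ℝ) + 1 by push_cast; ring,
      Real.Gamma_nat_eq_factorial, Real.Gamma_nat_eq_factorial,
      show 1 - (((2 * n : ℕ) : ℝ) + 1) = -((2 * n : ℕ) : ℝ) by ring, Real.rpow_neg (by norm_num),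
      Real.rpow_natCast] at hd
    have hn : (n.factorial : ℝ) ≠ 0 := by positivity
    rw [← eq_div_iff hn] at hd
    have hg := (Real.Gamma_pos_of_pos
      (show 0 < (n : ℝ) + μ / 2 + 1 by linarith [n.cast_nonneg (α := ℝ)])).ne'
    rw [hd, div_pow]
    field_simp
  · rw [norm_mul, Real.norm_eq_abs, Real.norm_eq_abs, abs_div, Nat.abs_cast, mul_pow, abs_mul,
      abs_of_nonneg ((even_two_mul n).pow_nonneg z), abs_pow]
    gcongr
    exact mul_le_of_le_one_right ((even_two_mul n).pow_nonneg z)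
      (pow_le_one₀ (abs_nonneg _) (Real.abs_cos_le_one t))

theorem image_sinh_Ioi : Real.sinh '' Ioi 0 = Ioi 0 := by
  ext u
  simp only [mem_image, mem_Ioi]
  exact ⟨fun ⟨p, hp, h⟩ => h ▸ Real.sinh_pos_iff.mpr hp,
    fun hu => ⟨Real.arsinh u, Real.arsinh_pos_iff.mpr hu, Real.sinh_arsinh u⟩⟩

theorem integrableOn_cosh_mul_comp_sinh {g : ℝ → ℝ} (hg : IntegrableOn g (Ioi 0)) :
    IntegrableOn (fun p => Real.cosh p * g (Real.sinh p)) (Ioi 0) := by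
  rw [← image_sinh_Ioi, integrableOn_image_iff_integrableOn_abs_deriv_smul measurableSet_Ioi
    (fun p _ => (Real.hasDerivAt_sinh p).hasDerivWithinAt) Real.sinh_injective.injOn] at hg
  simpa only [abs_of_pos (Real.cosh_pos _), smul_eq_mul] using hg

theorem integral_cosh_mul_comp_sinh (g : ℝ → ℝ) :
    ∫ p in Ioi (0 : ℝ), Real.cosh p * g (Real.sinh p) = ∫ u in Ioi (0 : ℝ), g u := by
  conv_rhs => rw [← image_sinh_Ioi, integral_image_eq_integral_abs_deriv_smul measurableSet_Ioi
    (fun p _ => (Real.hasDerivAt_sinh p).hasDerivWithinAt) Real.sinh_injective.injOn]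
  simp only [abs_of_pos (Real.cosh_pos _), smul_eq_mul]

theorem one_add_sq_div_two_le_cosh (s : ℝ) : 1 + s ^ 2 / 2 ≤ Real.cosh s := by
  have h1 := Real.cosh_two_mul (s / 2)
  have h2 := Real.cosh_sq (s / 2)
  have h3 : |s / 2| ≤ |Real.sinh (s / 2)| := by
    rw [Real.abs_sinh]
    exact Real.self_le_sinh_iff.mpr (abs_nonneg _)
  rw [← sq_le_sq] at h3
  rw [mul_div_cancel₀ s two_ne_zero] at h1
  nlinarith

theorem integrable_exp_neg_mul_cosh_add {b : ℝ} (hb : 0 < b) (β : ℝ) :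
    Integrable (fun s => Real.exp (-b * Real.cosh s + β * s)) := by
  refine ((integrable_exp_neg_mul_sq (b := b / 4) (by positivity)).const_mul
    (Real.exp (β ^ 2 / b))).mono' (by fun_prop) (ae_of_all _ fun s => ?_)
  rw [Real.norm_eq_abs, Real.abs_exp, ← Real.exp_add]
  refine Real.exp_le_exp.mpr ?_
  have h := mul_le_mul_of_nonneg_left (one_add_sq_div_two_le_cosh s) hb.le
  have h2 : β ^ 2 / b - β * s + b / 4 * s ^ 2 = (β - b * s / 2) ^ 2 / b := by
    field_simp
    ring
  have h3 : 0 ≤ (β - b * s / 2) ^ 2 / b := by positivity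
  linarith

theorem integral_exp_neg_mul_cosh_add {b : ℝ} (hb : 0 < b) (β : ℝ) :
    ∫ s, Real.exp (-b * Real.cosh s + β * s) = 2 * besselK β b := by
  have h := integrable_exp_neg_mul_cosh_add hb β
  have h' := integrable_exp_neg_mul_cosh_add hb (-β)
  have hneg : ∫ s in Iic (0 : ℝ), Real.exp (-b * Real.cosh s + β * s)
      = ∫ s in Ioi (0 : ℝ), Real.exp (-b * Real.cosh s + -β * s) := by
    have := integral_comp_neg_Ioi 0 fun s => Real.exp (-b * Real.cosh s + β * s)
    simpa using this.symm
  rw [← integral_add_compl measurableSet_Iic h, compl_Iic, hneg,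
    ← integral_add h'.integrableOn h.integrableOn, besselK, ← integral_const_mul]
  refine integral_congr_ae (ae_of_all _ fun s => ?_)
  simp only [Real.exp_add, Real.cosh_eq (β * s), neg_mul]
  ring

theorem integrableOn_and_integral_rpow_mul_exp_sub_div {b : ℝ} (hb : 0 < b) (β : ℝ) :
    IntegrableOn (fun v => v ^ (β - 1) * Real.exp (-v - b ^ 2 / (4 * v))) (Ioi 0) ∧
    ∫ v in Ioi (0 : ℝ), v ^ (β - 1) * Real.exp (-v - b ^ 2 / (4 * v))
      = 2 * (b / 2) ^ β * besselK β b := by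
  have himg : (fun s => b / 2 * Real.exp s) '' univ = Ioi 0 := by
    ext v
    simp only [image_univ, mem_range, mem_Ioi]
    refine ⟨fun ⟨s, hs⟩ => hs ▸ by positivity, fun hv => ⟨Real.log (v / (b / 2)), ?_⟩⟩
    rw [Real.exp_log (by positivity)]
    field_simp
  have hder : ∀ s ∈ univ, HasDerivWithinAt (fun s => b / 2 * Real.exp s)
      (b / 2 * Real.exp s) univ s := fun s _ =>
    ((Real.hasDerivAt_exp s).const_mul _).hasDerivWithinAt
  have hinj : InjOn (fun s => b / 2 * Real.exp s) univ := fun s _ s' _ h =>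
    Real.exp_injective (mul_left_cancel₀ (by positivity) h)
  have hfun : ∀ s, |b / 2 * Real.exp s| • ((b / 2 * Real.exp s) ^ (β - 1) *
      Real.exp (-(b / 2 * Real.exp s) - b ^ 2 / (4 * (b / 2 * Real.exp s))))
      = (b / 2) ^ β * Real.exp (-b * Real.cosh s + β * s) := by
    intro s
    have hv : 0 < b / 2 * Real.exp s := by positivity
    rw [abs_of_pos hv, smul_eq_mul, ← mul_assoc, Real.rpow_sub_one hv.ne',
      mul_div_cancel₀ _ hv.ne', Real.mul_rpow (by positivity) (by positivity),
      ← Real.exp_mul, mul_assoc, ← Real.exp_add, Real.cosh_eq, Real.exp_neg]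
    congr 2
    field_simp
    ring
  constructor
  · rw [← himg, integrableOn_image_iff_integrableOn_abs_deriv_smul MeasurableSet.univ hder hinj,
      integrableOn_univ]
    simp only [hfun]
    exact (integrable_exp_neg_mul_cosh_add hb β).const_mul _
  · rw [← himg, integral_image_eq_integral_abs_deriv_smul MeasurableSet.univ hder hinj,
      setIntegral_univ]
    simp only [hfun]
    rw [integral_const_mul, integral_exp_neg_mul_cosh_add hb]
    ring

theorem besselK_neg_half (b : ℝ) :
    besselK (-(1 / 2)) b = Real.sqrt (Real.pi / (2 * b)) * Real.exp (-b) := by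
  have h1 := integral_comp_mul_left_Ioi
    (fun p => Real.cosh p * (Real.exp (-b) * Real.exp (-(2 * b) * Real.sinh p ^ 2))) 0
    (b := 1 / 2) (by norm_num)
  rw [mul_zero, integral_cosh_mul_comp_sinh fun u => Real.exp (-b) * Real.exp (-(2 * b) * u ^ 2),
    integral_const_mul, integral_gaussian_Ioi] at h1
  calc besselK (-(1 / 2)) b = _ := ?_
    _ = _ := h1
    _ = _ := by rw [smul_eq_mul]; ring
  refine integral_congr_ae (ae_of_all _ fun s => ?_)
  have h2 := Real.cosh_two_mul (1 / 2 * s)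
  have h3 := Real.cosh_sq (1 / 2 * s)
  rw [← mul_assoc, mul_one_div_cancel two_ne_zero, one_mul] at h2
  simp only [neg_mul, Real.cosh_neg]
  rw [← Real.exp_add, mul_comm, h2, h3]
  congr 2
  ring

theorem integrableOn_exp_cosh_mul_sinh_rpow {ν : ℝ} (hν : -1 < ν) {z : ℝ} (hz : 0 < z) :
    IntegrableOn (fun p => Real.exp (-z * Real.cosh p) * Real.sinh p ^ ν) (Ioi 0) := by
  have h := integrableOn_cosh_mul_comp_sinh
    (integrableOn_rpow_mul_exp_neg_mul_rpow hν one_pos hz)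
  refine Integrable.mono' h (by fun_prop) ?_
  refine (ae_restrict_iff' measurableSet_Ioi).mpr (ae_of_all _ fun p hp => ?_)
  have hs : 0 < Real.sinh p := Real.sinh_pos_iff.mpr hp
  rw [Real.norm_of_nonneg (by positivity), Real.rpow_one, mul_comm (Real.exp _)]
  refine le_trans ?_ (le_mul_of_one_le_left (by positivity) (Real.one_le_cosh p))
  gcongr ?_ * Real.exp ?_
  have := (Real.sinh_lt_cosh p).le
  nlinarith

theorem integrableOn_and_integral_cosh_mul_sinh_rpow_mul_exp {ν : ℝ} (hν : -1 < ν) {k : ℝ}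
    (hk : 0 < k) :
    IntegrableOn (fun p => Real.cosh p * (Real.sinh p ^ ν * Real.exp (-k * Real.sinh p ^ 2)))
      (Ioi 0) ∧
    ∫ p in Ioi (0 : ℝ), Real.cosh p * (Real.sinh p ^ ν * Real.exp (-k * Real.sinh p ^ 2))
      = k ^ (-((ν + 1) / 2)) * Real.Gamma ((ν + 1) / 2) / 2 := by
  refine ⟨integrableOn_cosh_mul_comp_sinh (integrableOn_rpow_mul_exp_neg_mul_sq hk hν), ?_⟩
  rw [integral_cosh_mul_comp_sinh fun u => u ^ ν * Real.exp (-k * u ^ 2)]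
  simp only [← Real.rpow_two]
  rw [integral_rpow_mul_exp_neg_mul_rpow two_pos hν hk, neg_div]
  ring

theorem integral_exp_cosh_mul_sinh_rpow {ν : ℝ} (hν : -1 < ν) {z : ℝ} (hz : 0 < z) :
    ∫ p in Ioi (0 : ℝ), Real.exp (-z * Real.cosh p) * Real.sinh p ^ ν
      = Real.Gamma ((ν + 1) / 2) / Real.sqrt Real.pi * tildeK (ν / 2) z := by
  let F : ℝ → ℝ → ℝ := fun p v => Real.cosh p * Real.sinh p ^ ν *
    (v ^ (-(1 / 2) - 1 : ℝ) * Real.exp (-v - (z * Real.cosh p) ^ 2 / (4 * v)))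
  have hleft : ∀ p, ∫ v in Ioi (0 : ℝ), F p v
      = 2 * Real.sqrt Real.pi / z * (Real.exp (-z * Real.cosh p) * Real.sinh p ^ ν) := by
    intro p
    have hc := Real.cosh_pos p
    have hb : 0 < z * Real.cosh p := by positivity
    rw [integral_const_mul, (integrableOn_and_integral_rpow_mul_exp_sub_div hb _).2,
      besselK_neg_half, Real.rpow_neg (by positivity), ← Real.sqrt_eq_rpow,
      Real.sqrt_div Real.pi_pos.le, show 2 * (z * Real.cosh p) = 2 ^ 2 * (z * Real.cosh p / 2) by ring,
      Real.sqrt_mul (by norm_num), Real.sqrt_sq (by norm_num)]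
    have hs := Real.mul_self_sqrt (show 0 ≤ z * Real.cosh p / 2 by positivity)
    have hs0 : Real.sqrt (z * Real.cosh p / 2) ≠ 0 := by positivity
    generalize Real.sqrt (z * Real.cosh p / 2) = r at hs hs0 ⊢
    field_simp
    linear_combination -2 * Real.sinh p ^ ν * hs
  have hF : ∀ v ∈ Ioi (0 : ℝ), ∀ p, F p v
      = v ^ (-(1 / 2) - 1 : ℝ) * Real.exp (-v - z ^ 2 / (4 * v)) *
        (Real.cosh p * (Real.sinh p ^ ν * Real.exp (-(z ^ 2 / (4 * v)) * Real.sinh p ^ 2))) := by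
    intro v hv p
    have hv' : v ≠ 0 := ne_of_gt hv
    have : -v - (z * Real.cosh p) ^ 2 / (4 * v)
        = (-v - z ^ 2 / (4 * v)) + -(z ^ 2 / (4 * v)) * Real.sinh p ^ 2 := by
      rw [mul_pow, Real.cosh_sq]
      ring
    simp only [F]
    rw [this, Real.exp_add]
    ring
  have hright : ∀ v ∈ Ioi (0 : ℝ), ∫ p in Ioi (0 : ℝ), F p v
      = (z / 2) ^ (-(ν + 1)) * Real.Gamma ((ν + 1) / 2) / 2 *
        (v ^ (ν / 2 - 1) * Real.exp (-v - z ^ 2 / (4 * v))) := by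
    intro v hv
    have hv' : 0 < v := hv
    simp only [hF v hv]
    rw [integral_const_mul,
      (integrableOn_and_integral_cosh_mul_sinh_rpow_mul_exp hν (by positivity)).2,
      show z ^ 2 / (4 * v) = (z / 2) ^ 2 / v by ring, Real.div_rpow (by positivity) hv'.le,
      ← Real.rpow_natCast, ← Real.rpow_mul (by positivity), Real.rpow_neg hv'.le, div_inv_eq_mul,
      show ν / 2 - 1 = (-(1 / 2) - 1) + (ν + 1) / 2 by ring, Real.rpow_add hv',
      show ((2 : ℕ) : ℝ) * -((ν + 1) / 2) = -(ν + 1) by push_cast; ring]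
    ring
  have hpos : ∀ᵐ v ∂volume.restrict (Ioi (0 : ℝ)), ∀ᵐ p ∂volume.restrict (Ioi (0 : ℝ)),
      ‖F p v‖ = F p v := by
    refine (ae_restrict_iff' measurableSet_Ioi).mpr (ae_of_all _ fun v hv => ?_)
    refine (ae_restrict_iff' measurableSet_Ioi).mpr (ae_of_all _ fun p hp => ?_)
    have hs : 0 < Real.sinh p := Real.sinh_pos_iff.mpr hp
    have hv' : 0 < v := hv
    have hc := Real.cosh_pos p
    exact Real.norm_of_nonneg (by positivity)
  have hint : Integrable (Function.uncurry F)
      ((volume.restrict (Ioi 0)).prod (volume.restrict (Ioi 0))) := by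
    rw [integrable_prod_iff' (Measurable.aestronglyMeasurable (by unfold F; fun_prop))]
    constructor
    · refine (ae_restrict_iff' measurableSet_Ioi).mpr (ae_of_all _ fun v hv => ?_)
      have hv' : 0 < v := hv
      simp only [Function.uncurry, hF v hv]
      exact ((integrableOn_and_integral_cosh_mul_sinh_rpow_mul_exp hν (by positivity)).1).const_mul _
    · refine Integrable.congr (((integrableOn_and_integral_rpow_mul_exp_sub_div hz (ν / 2)).1).const_mul
        ((z / 2) ^ (-(ν + 1)) * Real.Gamma ((ν + 1) / 2) / 2)) ?_
      filter_upwards [hpos, ae_restrict_mem measurableSet_Ioi] with v hv hv0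
      rw [← hright v hv0]
      exact (integral_congr_ae hv).symm
  have hswap := integral_integral_swap hint
  simp only [hleft] at hswap
  rw [setIntegral_congr_fun measurableSet_Ioi hright, integral_const_mul, integral_const_mul,
    (integrableOn_and_integral_rpow_mul_exp_sub_div hz (ν / 2)).2] at hswap
  have hz2 : (z / 2) ^ (-(ν + 1)) * (z / 2) ^ (ν / 2) = (z / 2) ^ (-(ν / 2)) * (z / 2)⁻¹ := by
    rw [← Real.rpow_neg_one, ← Real.rpow_add (by positivity), ← Real.rpow_add (by positivity)]
    congr 1
    ring
  have hpi : Real.sqrt Real.pi ≠ 0 := by positivity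
  rw [tildeK]
  have key : ∀ I : ℝ, I = z / (2 * Real.sqrt Real.pi) * (2 * Real.sqrt Real.pi / z * I) := by
    intro I
    field_simp
  rw [key (∫ p in Ioi (0 : ℝ), _), hswap]
  rw [inv_div] at hz2
  have := congrArg (fun y => z / Real.sqrt Real.pi * (Real.Gamma ((ν + 1) / 2) / 2) *
    besselK (ν / 2) z * y) hz2
  calc _ = _ := by ring
    _ = _ := this
    _ = _ := by field_simp

theorem Lambda₁_eq_integral {μ ν : ℝ} (hμ : -1 < μ) (hν : -1 < ν) (j : ℕ) {x : ℝ} (hx : 0 < x) :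
    Lambda₁ μ ν j x
      = (Real.pi * Real.Gamma ((μ + 1) / 2) * Real.Gamma ((ν + 1) / 2))⁻¹ *
          ∫ t in Ioo (0 : ℝ) Real.pi, ∫ p in Ioo (0 : ℝ) Real.pi,
            Real.exp (-x * Real.cos p) *
              laguerreL j ((μ + ν) / 2) (x * (Real.cos t + Real.cos p)) *
              Real.sin t ^ μ * Real.sin p ^ ν := by
  have hcg : IntegrableOn (fun p => Real.exp (-x * Real.cos p) * |Real.sin p ^ ν| *
      Real.exp (x * |Real.cos p| / 2)) (Ioo 0 Real.pi) := by
    refine (integrableOn_continuous_mul_sin_rpow hν (h := fun p => Real.exp (-x * Real.cos p) *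
      Real.exp (x * |Real.cos p| / 2)) (by fun_prop)).congr_fun (fun p hp => ?_) measurableSet_Ioo
    have hs := Real.sin_pos_of_pos_of_lt_pi hp.1 hp.2
    simp only
    rw [abs_of_pos (show 0 < Real.sin p ^ ν by positivity)]
    ring
  refine iteratedDeriv_div_factorial_of_hasSum (g := fun t => genG₁ μ ν t x)
    (a := fun n => (Real.pi * Real.Gamma ((μ + 1) / 2) * Real.Gamma ((ν + 1) / 2))⁻¹ *
      ∫ t in Ioo (0 : ℝ) Real.pi, ∫ p in Ioo (0 : ℝ) Real.pi, Real.exp (-x * Real.cos p) *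
        laguerreL n ((μ + ν) / 2) (x * (Real.cos t + Real.cos p)) * Real.sin t ^ μ * Real.sin p ^ ν)
    (r := 1 / 3) (by norm_num) (fun s hs => ?_) j
  have h := (hasSum_integral_integral_laguerreL (α := (μ + ν) / 2) (by linarith) hx
    (integrableOn_and_integral_sin_rpow hμ).1 Real.continuous_cos
    (integrableOn_and_integral_sin_rpow hν).1.1 hcg hs.le).mul_left
    (Real.pi * Real.Gamma ((μ + 1) / 2) * Real.Gamma ((ν + 1) / 2))⁻¹
  rw [integral_exp_cos_mul_sin_rpow hμ, integral_exp_cos_mul_sin_rpow hν] at h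
  refine (iff_of_eq (congrArg (fun y => HasSum _ y) ?_)).mp (HasSum.congr_fun h fun n => mul_assoc _ _ _)
  have hΓμ := (Real.Gamma_pos_of_pos (show 0 < (μ + 1) / 2 by linarith)).ne'
  have hΓν := (Real.Gamma_pos_of_pos (show 0 < (ν + 1) / 2 by linarith)).ne'
  rw [genG₁, show -(μ + ν + 2) / 2 = -((μ + ν) / 2 + 1) by ring]
  have hpi := Real.mul_self_sqrt Real.pi_pos.le
  nth_rw 1 [← hpi]
  field_simp

theorem Lambda₂_eq_integral {μ ν : ℝ} (hμ : -1 < μ) (hν : -1 < ν) (j : ℕ) {x : ℝ} (hx : 0 < x) :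
    Lambda₂ μ ν j x
      = (Real.Gamma ((μ + 1) / 2) * Real.Gamma ((ν + 1) / 2))⁻¹ *
          ∫ t in Ioo (0 : ℝ) Real.pi, ∫ p in Ioi (0 : ℝ),
            Real.exp (-x * Real.cosh p) *
              laguerreL j ((μ + ν) / 2) (x * (Real.cos t + Real.cosh p)) *
              Real.sin t ^ μ * Real.sinh p ^ ν := by
  have hcg : IntegrableOn (fun p => Real.exp (-x * Real.cosh p) * |Real.sinh p ^ ν| *
      Real.exp (x * |Real.cosh p| / 2)) (Ioi 0) := by
    refine (integrableOn_exp_cosh_mul_sinh_rpow hν (half_pos hx)).congr_fun (fun p hp => ?_)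
      measurableSet_Ioi
    have hs : 0 < Real.sinh p := Real.sinh_pos_iff.mpr hp
    simp only
    rw [abs_of_pos (by positivity), abs_of_pos (Real.cosh_pos p), mul_right_comm, ← Real.exp_add]
    congr 2
    ring
  refine iteratedDeriv_div_factorial_of_hasSum (g := fun t => genG₂ μ ν t x)
    (a := fun n => (Real.Gamma ((μ + 1) / 2) * Real.Gamma ((ν + 1) / 2))⁻¹ *
      ∫ t in Ioo (0 : ℝ) Real.pi, ∫ p in Ioi (0 : ℝ), Real.exp (-x * Real.cosh p) *
        laguerreL n ((μ + ν) / 2) (x * (Real.cos t + Real.cosh p)) * Real.sin t ^ μ * Real.sinh p ^ ν)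
    (r := 1 / 3) (by norm_num) (fun s hs => ?_) j
  have h := (hasSum_integral_integral_laguerreL (α := (μ + ν) / 2) (by linarith) hx
    (integrableOn_and_integral_sin_rpow hμ).1 Real.continuous_cosh
    (m₂ := volume.restrict (Ioi 0)) (g := fun p => Real.sinh p ^ ν)
    (Measurable.aestronglyMeasurable (by fun_prop)) hcg hs.le).mul_left
    (Real.Gamma ((μ + 1) / 2) * Real.Gamma ((ν + 1) / 2))⁻¹
  have hs1 : 0 < 1 - s := by linarith [(abs_lt.mp hs).2]
  rw [integral_exp_cos_mul_sin_rpow hμ, integral_exp_cosh_mul_sinh_rpow hν (by positivity)] at h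
  refine (iff_of_eq (congrArg (fun y => HasSum _ y) ?_)).mp (HasSum.congr_fun h fun n => mul_assoc _ _ _)
  have hΓμ := (Real.Gamma_pos_of_pos (show 0 < (μ + 1) / 2 by linarith)).ne'
  have hΓν := (Real.Gamma_pos_of_pos (show 0 < (ν + 1) / 2 by linarith)).ne'
  rw [genG₂, show -(μ + ν + 2) / 2 = -((μ + ν) / 2 + 1) by ring]
  have hpi : Real.sqrt Real.pi ≠ 0 := by positivity
  field_simp

/-- Double integral representations of `Λ_{1,j}^{μ,ν}` and `Λ_{2,j}^{μ,ν}` in terms of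
Laguerre polynomials, for `μ, ν > −1`. -/
theorem statement12 (μ ν : ℝ) (hμ : -1 < μ) (hν : -1 < ν) (j : ℕ) (x : ℝ) (hx : 0 < x) :
    Lambda₁ μ ν j x
      = (Real.pi * Real.Gamma ((μ + 1) / 2) * Real.Gamma ((ν + 1) / 2))⁻¹ *
          ∫ t in Ioo (0 : ℝ) Real.pi, ∫ p in Ioo (0 : ℝ) Real.pi,
            Real.exp (-x * Real.cos p) *
              laguerreL j ((μ + ν) / 2) (x * (Real.cos t + Real.cos p)) *
              Real.sin t ^ μ * Real.sin p ^ ν ∧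
    Lambda₂ μ ν j x
      = (Real.Gamma ((μ + 1) / 2) * Real.Gamma ((ν + 1) / 2))⁻¹ *
          ∫ t in Ioo (0 : ℝ) Real.pi, ∫ p in Ioi (0 : ℝ),
            Real.exp (-x * Real.cosh p) *
              laguerreL j ((μ + ν) / 2) (x * (Real.cos t + Real.cosh p)) *
              Real.sin t ^ μ * Real.sinh p ^ ν := by
  exact ⟨Lambda₁_eq_integral hμ hν j hx, Lambda₂_eq_integral hμ hν j hx⟩
end
end
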